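/- arXiv:1712.04728 — 14 statements merged into one kernel-verified Lean document; each statement's English description precedes it below -/
import Mathlib

section
/- Let A be a commutative ring, let J, U ⊆ A be subsets and let x ∈ A. If the idealistic prime (J ∪ {x}, U) collapses and the idealistic prime (J, U ∪ {x}) collapses, then the idealistic prime (J, U) collapses. -/
/-- In a commutative ring `A`, the idealistic prime `(J, U)` collapses if the
multiplicative submonoid generated by `U` meets the ideal generated by `J`,
i.e. `0 ∈ ⟨J⟩ + M(U)`. -/
def PrimeCollapses {A : Type*} [CommRing A] (J U : Set A) : Prop :=
  ∃ j ∈ Ideal.span J, ∃ u ∈ Submonoid.closure U, j + u = (0 : A)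

/-- Simultaneous collapse for idealistic primes: if `(J ∪ {x}, U)` and
`(J, U ∪ {x})` both collapse, then `(J, U)` collapses. -/
theorem simultaneous_collapse_primes {A : Type*} [CommRing A] (J U : Set A) (x : A)
    (h1 : PrimeCollapses (insert x J) U) (h2 : PrimeCollapses J (insert x U)) :
    PrimeCollapses J U := by
  obtain ⟨j₁, hj₁, u, hu, e₁⟩ := h1
  obtain ⟨j₂, hj₂, w, hw, e₂⟩ := h2
  obtain ⟨a, j, hj, rfl⟩ := Ideal.mem_span_insert.1 hj₁
  rw [Set.insert_eq, Submonoid.closure_union] at hw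
  obtain ⟨y, hy, v, hv, rfl⟩ := Submonoid.mem_sup.1 hw
  obtain ⟨n, rfl⟩ := Submonoid.mem_closure_singleton.1 hy
  refine ⟨-(u ^ n * v), ?_, u ^ n * v, mul_mem (pow_mem hu n) hv, neg_add_cancel _⟩
  obtain ⟨c, hc⟩ := sub_dvd_pow_sub_pow u (-(a * x)) n
  have key : -(u ^ n * v) = c * v * j + (-a) ^ n * j₂ := by
    have hpow : (-(a * x)) ^ n = (-a) ^ n * x ^ n := by rw [← neg_mul, mul_pow]
    rw [hpow] at hc
    linear_combination (-v) * hc - c * v * e₁ - (-a) ^ n * e₂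
  rw [key]
  exact add_mem (Ideal.mul_mem_left _ _ hj) (Ideal.mul_mem_left _ _ hj₂)
end

section
/- Let A be a commutative ring, ℓ ∈ ℕ, and let C = ((J₀,U₀),…,(J_ℓ,U_ℓ)) be a family of ℓ+1 pairs of subsets of A. Fix x ∈ A and an index i ∈ {0,…,ℓ}. If the chain obtained from C by replacing Jᵢ with Jᵢ ∪ {x} collapses, and the chain obtained from C by replacing Uᵢ with Uᵢ ∪ {x} collapses, then C itself collapses. -/
/-- The nested value `u₀·(u₁·(⋯(u_ℓ + j_ℓ)⋯) + j₁) + j₀` associated to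
an idealistic chain of length `ℓ` (indices `0,…,ℓ`). -/
def chainVal {A : Type*} [CommRing A] (u j : ℕ → A) : ℕ → A
  | 0 => u 0 + j 0
  | n + 1 => u 0 * chainVal (fun i => u (i + 1)) (fun i => j (i + 1)) n + j 0

/-- An idealistic chain `((J₀,U₀),…,(J_ℓ,U_ℓ))` in a commutative ring collapses
if there are `jᵢ ∈ ⟨Jᵢ⟩` and `uᵢ ∈ M(Uᵢ)` with
`u₀·(u₁·(⋯(u_ℓ + j_ℓ)⋯) + j₁) + j₀ = 0`. -/
def ChainCollapses {A : Type*} [CommRing A] (J U : ℕ → Set A) (ℓ : ℕ) : Prop :=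
  ∃ j u : ℕ → A, (∀ i ≤ ℓ, j i ∈ Ideal.span (J i)) ∧
    (∀ i ≤ ℓ, u i ∈ Submonoid.closure (U i)) ∧ chainVal u j ℓ = 0

/-- The submonoid `S + I` of a commutative ring. -/
def Submonoid.addIdeal {A : Type*} [CommRing A] (S : Submonoid A) (I : Ideal A) :
    Submonoid A where
  carrier := {y | ∃ s ∈ S, ∃ a ∈ I, s + a = y}
  one_mem' := ⟨1, S.one_mem, 0, I.zero_mem, add_zero 1⟩
  mul_mem' := by
    rintro _ _ ⟨s, hs, a, ha, rfl⟩ ⟨t, ht, b, hb, rfl⟩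
    refine ⟨s * t, S.mul_mem hs ht, s * b + (t + b) * a,
      I.add_mem (I.mul_mem_left _ hb) (I.mul_mem_left _ ha), by ring⟩

theorem Submonoid.mem_addIdeal {A : Type*} [CommRing A] {S : Submonoid A} {I : Ideal A}
    {y : A} : y ∈ S.addIdeal I ↔ ∃ s ∈ S, ∃ a ∈ I, s + a = y :=
  Iff.rfl

/-- The ideal of elements sent into `I` by some element of `S`. -/
def Ideal.saturationBy {A : Type*} [CommRing A] (I : Ideal A) (S : Submonoid A) :
    Ideal A where
  carrier := {y | ∃ s ∈ S, s * y ∈ I}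
  zero_mem' := ⟨1, S.one_mem, by simp⟩
  add_mem' := by
    rintro y z ⟨s, hs, hy⟩ ⟨t, ht, hz⟩
    refine ⟨s * t, S.mul_mem hs ht, ?_⟩
    have h := I.add_mem (I.mul_mem_left t hy) (I.mul_mem_left s hz)
    convert h using 1
    ring
  smul_mem' := by
    rintro c y ⟨s, hs, hy⟩
    refine ⟨s, hs, ?_⟩
    have h := I.mul_mem_left c hy
    convert h using 1
    simp only [smul_eq_mul]
    ring

/-- The submonoid of all values of an idealistic chain. -/
def chainMonoid {A : Type*} [CommRing A] (J U : ℕ → Set A) : ℕ → Submonoid A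
  | 0 => (Submonoid.closure (U 0)).addIdeal (Ideal.span (J 0))
  | n + 1 => (Submonoid.closure (U 0) ⊔
      chainMonoid (fun k => J (k + 1)) (fun k => U (k + 1)) n).addIdeal (Ideal.span (J 0))

theorem mem_chainMonoid_iff {A : Type*} [CommRing A] (J U : ℕ → Set A) (ℓ : ℕ) (y : A) :
    y ∈ chainMonoid J U ℓ ↔ ∃ j u : ℕ → A, (∀ i ≤ ℓ, j i ∈ Ideal.span (J i)) ∧
      (∀ i ≤ ℓ, u i ∈ Submonoid.closure (U i)) ∧ chainVal u j ℓ = y := by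
  induction ℓ generalizing J U y with
  | zero =>
    rw [chainMonoid, Submonoid.mem_addIdeal]
    constructor
    · rintro ⟨s, hs, a, ha, rfl⟩
      refine ⟨fun _ => a, fun _ => s, ?_, ?_, rfl⟩ <;>
      · intro i hi
        obtain rfl : i = 0 := by omega
        assumption
    · rintro ⟨j, u, hj, hu, rfl⟩
      exact ⟨u 0, hu 0 le_rfl, j 0, hj 0 le_rfl, rfl⟩
  | succ n ih =>
    rw [chainMonoid, Submonoid.mem_addIdeal]
    constructor
    · rintro ⟨_, hsv, a, ha, rfl⟩
      obtain ⟨s, hs, v, hv, rfl⟩ := Submonoid.mem_sup.1 hsv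
      obtain ⟨j, u, hj, hu, rfl⟩ := (ih _ _ _).1 hv
      refine ⟨fun k => Nat.casesOn k a j, fun k => Nat.casesOn k s u, ?_, ?_, rfl⟩
      · rintro (_ | k) hk
        · exact ha
        · exact hj k (by omega)
      · rintro (_ | k) hk
        · exact hs
        · exact hu k (by omega)
    · rintro ⟨j, u, hj, hu, rfl⟩
      exact ⟨_, Submonoid.mul_mem_sup (hu 0 (by omega))
        ((ih _ _ _).2 ⟨_, _, fun k hk => hj (k + 1) (by omega),
          fun k hk => hu (k + 1) (by omega), rfl⟩), j 0, hj 0 (by omega), rfl⟩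

theorem chainCollapses_iff_zero_mem {A : Type*} [CommRing A] (J U : ℕ → Set A) (ℓ : ℕ) :
    ChainCollapses J U ℓ ↔ (0 : A) ∈ chainMonoid J U ℓ :=
  (mem_chainMonoid_iff J U ℓ 0).symm

theorem exists_mem_addIdeal_sup_iff {A : Type*} [CommRing A] (S T : Submonoid A)
    (I N : Ideal A) :
    (∃ y ∈ (S ⊔ T).addIdeal I, y ∈ N) ↔ ∃ t ∈ T, t ∈ (N ⊔ I).saturationBy S := by
  constructor
  · rintro ⟨_, ⟨_, hst, a, ha, rfl⟩, hN⟩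
    obtain ⟨s, hs, t, ht, rfl⟩ := Submonoid.mem_sup.1 hst
    refine ⟨t, ht, s, hs, ?_⟩
    rw [← add_sub_cancel_right (s * t) a]
    exact sub_mem (Ideal.mem_sup_left hN) (Ideal.mem_sup_right ha)
  · rintro ⟨t, ht, s, hs, hst⟩
    obtain ⟨n, hn, a, ha, hna⟩ := Submodule.mem_sup.1 hst
    refine ⟨n, ⟨s * t, Submonoid.mul_mem_sup hs ht, -a, I.neg_mem ha, ?_⟩, hn⟩
    rw [← hna]
    ring

/-- Simultaneous collapse at a single level, modulo an ideal `N`. -/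
theorem exists_mem_addIdeal_of_insert {A : Type*} [CommRing A] (R : Submonoid A)
    (J : Set A) (N : Ideal A) (x : A)
    (h1 : ∃ y ∈ R.addIdeal (Ideal.span (insert x J)), y ∈ N)
    (h2 : ∃ y ∈ (Submonoid.closure {x} ⊔ R).addIdeal (Ideal.span J), y ∈ N) :
    ∃ y ∈ R.addIdeal (Ideal.span J), y ∈ N := by
  obtain ⟨_, ⟨r, hr, b, hb, rfl⟩, hN⟩ := h1
  obtain ⟨a, c, hc, rfl⟩ := Ideal.mem_span_insert.1 hb
  obtain ⟨t, ht, p, hp, hpt⟩ := (exists_mem_addIdeal_sup_iff _ _ _ _).1 h2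
  obtain ⟨n, rfl⟩ := Submonoid.mem_closure_singleton.1 hp
  set K := N ⊔ Ideal.span J
  have hrx : r - -(a * x) ∈ K := by
    have h := K.sub_mem (Ideal.mem_sup_left hN) (Ideal.mem_sup_right hc)
    convert h using 1
    ring
  have hpow : r ^ n - (-(a * x)) ^ n ∈ K :=
    K.mem_of_dvd (sub_dvd_pow_sub_pow _ _ n) hrx
  have hrt : r ^ n * t ∈ K := by
    have h := K.add_mem (K.mul_mem_left t hpow) (K.mul_mem_left ((-a) ^ n) hpt)
    convert h using 1
    rw [← neg_mul, mul_pow]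
    ring
  obtain ⟨m, hm, d, hd, hmd⟩ := Submodule.mem_sup.1 hrt
  refine ⟨m, ⟨r ^ n * t, R.mul_mem (R.pow_mem hr n) ht, -d, neg_mem hd, ?_⟩, hm⟩
  rw [← hmd]
  ring

theorem Submonoid.closure_insert_eq_sup {M : Type*} [Monoid M] (x : M) (U : Set M) :
    Submonoid.closure (insert x U) = Submonoid.closure {x} ⊔ Submonoid.closure U := by
  rw [← Submonoid.closure_union, Set.singleton_union]

theorem update_succ_shift {α : Type*} (f : ℕ → α) (i : ℕ) (a : α) :
    (fun k => Function.update f (i + 1) a (k + 1)) =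
      Function.update (fun k => f (k + 1)) i a :=
  Function.update_comp_eq_of_injective f (add_left_injective 1) i a

/-- Simultaneous collapse for idealistic chains, modulo an ideal `N`. -/
theorem exists_mem_chainMonoid_of_update {A : Type*} [CommRing A]
    (J U : ℕ → Set A) (ℓ : ℕ) (x : A) (i : ℕ) (hi : i ≤ ℓ) (N : Ideal A)
    (h1 : ∃ y ∈ chainMonoid (Function.update J i (insert x (J i))) U ℓ, y ∈ N)
    (h2 : ∃ y ∈ chainMonoid J (Function.update U i (insert x (U i))) ℓ, y ∈ N) :
    ∃ y ∈ chainMonoid J U ℓ, y ∈ N := by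
  induction i generalizing J U ℓ N with
  | zero =>
    cases ℓ with
    | zero =>
      simp only [chainMonoid, Function.update_self, Submonoid.closure_insert_eq_sup] at h1 h2 ⊢
      exact exists_mem_addIdeal_of_insert _ _ _ x h1 h2
    | succ n =>
      simp only [chainMonoid, Function.update_self, Submonoid.closure_insert_eq_sup, sup_assoc,
        Function.update_of_ne (Nat.succ_ne_zero _)] at h1 h2 ⊢
      exact exists_mem_addIdeal_of_insert _ _ _ x h1 h2
  | succ i ih =>
    obtain ⟨n, rfl⟩ : ∃ n, ℓ = n + 1 := ⟨ℓ - 1, by omega⟩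
    simp only [chainMonoid, update_succ_shift, exists_mem_addIdeal_sup_iff,
      Function.update_of_ne (Nat.succ_ne_zero i).symm] at h1 h2 ⊢
    exact ih _ _ n (by omega) _ h1 h2

/-- Simultaneous collapse for idealistic chains: if the chain obtained by
adding `x` to `Jᵢ` collapses, and the chain obtained by adding `x` to `Uᵢ`
collapses, then the chain itself collapses. -/
theorem simultaneous_collapse_chains {A : Type*} [CommRing A]
    (J U : ℕ → Set A) (ℓ : ℕ) (x : A) (i : ℕ) (hi : i ≤ ℓ)
    (h1 : ChainCollapses (Function.update J i (insert x (J i))) U ℓ)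
    (h2 : ChainCollapses J (Function.update U i (insert x (U i))) ℓ) :
    ChainCollapses J U ℓ := by
  rw [chainCollapses_iff_zero_mem] at h1 h2 ⊢
  obtain ⟨y, hy, hy0⟩ := exists_mem_chainMonoid_of_update J U ℓ x i hi ⊥
    ⟨0, h1, zero_mem _⟩ ⟨0, h2, zero_mem _⟩
  rwa [Ideal.mem_bot.1 hy0] at hy
end

section
/- Let A be a commutative ring and x₁, …, x_ℓ ∈ A. The sequence (x₁,…,x_ℓ) is not singular if and only if there exist prime ideals P₀ ⊆ P₁ ⊆ ⋯ ⊆ P_ℓ of A such that xᵢ ∈ Pᵢ and xᵢ ∉ P_{i−1} for each i = 1, …, ℓ. -/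
/-- The nested value
`x₁^{m₁}·(x₂^{m₂}·(⋯(x_ℓ^{m_ℓ}·(1 + a_ℓ·x_ℓ) + ⋯) + a₂·x₂) + a₁·x₁)`
associated to the sequence `x₁,…,x_ℓ` (the last argument is `ℓ`; the sequence
is indexed starting at `1`). -/
def singVal {A : Type*} [CommRing A] (x a : ℕ → A) (m : ℕ → ℕ) : ℕ → A
  | 0 => 1
  | n + 1 =>
      x 1 ^ m 1 *
        (singVal (fun i => x (i + 1)) (fun i => a (i + 1)) (fun i => m (i + 1)) n + a 1 * x 1)

/-- The sequence `x₁,…,x_ℓ` is singular if there exist `a₁,…,a_ℓ` and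
`m₁,…,m_ℓ` with
`x₁^{m₁}·(x₂^{m₂}·(⋯(x_ℓ^{m_ℓ}·(1 + a_ℓ·x_ℓ) + ⋯) + a₂·x₂) + a₁·x₁) = 0`. -/
def IsSingular {A : Type*} [CommRing A] (x : ℕ → A) (ℓ : ℕ) : Prop :=
  ∃ a : ℕ → A, ∃ m : ℕ → ℕ, singVal x a m ℓ = 0

/-- The values `singVal x a m n`, for varying `a` and `m`, form a submonoid. -/
def singSubmonoid {A : Type*} [CommRing A] (x : ℕ → A) : ℕ → Submonoid A
  | 0 => ⊥
  | n + 1 =>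
    { carrier := {y | ∃ s ∈ singSubmonoid (fun i => x (i + 1)) n, ∃ (b : A) (k : ℕ),
        y = x 1 ^ k * (s + b * x 1)}
      one_mem' := ⟨1, one_mem _, 0, 0, by simp⟩
      mul_mem' := by
        rintro _ _ ⟨s, hs, b, k, rfl⟩ ⟨t, ht, c, l, rfl⟩
        exact ⟨s * t, mul_mem hs ht, s * c + t * b + b * c * x 1, k + l, by ring⟩ }

theorem mem_singSubmonoid_succ {A : Type*} [CommRing A] {x : ℕ → A} {n : ℕ} {y : A} :
    y ∈ singSubmonoid x (n + 1) ↔ ∃ s ∈ singSubmonoid (fun i => x (i + 1)) n,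
      ∃ (b : A) (k : ℕ), y = x 1 ^ k * (s + b * x 1) :=
  Iff.rfl

/-- Elements of `singSubmonoid x n` are values of `singVal`; the unused entries of index `0` can be
prescribed. -/
theorem exists_singVal_eq_of_mem {A : Type*} [CommRing A] {x : ℕ → A} {n : ℕ} {y : A}
    (hy : y ∈ singSubmonoid x n) (a₀ : A) (m₀ : ℕ) :
    ∃ (a : ℕ → A) (m : ℕ → ℕ), a 0 = a₀ ∧ m 0 = m₀ ∧ singVal x a m n = y := by
  induction n generalizing x y a₀ m₀ with
  | zero => exact ⟨fun _ => a₀, fun _ => m₀, rfl, rfl, (Submonoid.mem_bot.1 hy).symm⟩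
  | succ n ih =>
    obtain ⟨s, hs, b, k, rfl⟩ := mem_singSubmonoid_succ.1 hy
    obtain ⟨a, m, rfl, rfl, rfl⟩ := ih hs b k
    exact ⟨fun i => Nat.casesOn i a₀ a, fun i => Nat.casesOn i m₀ m, rfl, rfl, rfl⟩

theorem singVal_mem_singSubmonoid {A : Type*} [CommRing A] (x a : ℕ → A) (m : ℕ → ℕ) (n : ℕ) :
    singVal x a m n ∈ singSubmonoid x n := by
  induction n generalizing x a m with
  | zero => exact one_mem _
  | succ n ih => exact mem_singSubmonoid_succ.2 ⟨_, ih _ _ _, a 1, m 1, rfl⟩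

theorem isSingular_iff_zero_mem {A : Type*} [CommRing A] {x : ℕ → A} {n : ℕ} :
    IsSingular x n ↔ (0 : A) ∈ singSubmonoid x n := by
  constructor
  · rintro ⟨a, m, h⟩
    exact h ▸ singVal_mem_singSubmonoid x a m n
  · intro h
    obtain ⟨a, m, -, -, h₀⟩ := exists_singVal_eq_of_mem h 0 0
    exact ⟨a, m, h₀⟩

/-- A prime ideal disjoint from `singSubmonoid x n` is the bottom of a chain of primes. -/
theorem exists_chain_of_disjoint {A : Type*} [CommRing A] {x : ℕ → A} {n : ℕ} {p : Ideal A}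
    (hp : p.IsPrime) (hd : Disjoint (p : Set A) (singSubmonoid x n)) :
    ∃ P : ℕ → Ideal A, P 0 = p ∧ (∀ i ≤ n, (P i).IsPrime) ∧ (∀ i < n, P i ≤ P (i + 1)) ∧
      ∀ i < n, x (i + 1) ∈ P (i + 1) ∧ x (i + 1) ∉ P i := by
  induction n generalizing x p with
  | zero => exact ⟨fun _ => p, rfl, fun _ _ => hp, by simp, by simp⟩
  | succ n ih =>
    have hx : x 1 ∉ p := fun h =>
      Set.disjoint_left.1 hd h (mem_singSubmonoid_succ.2 ⟨1, one_mem _, 0, 1, by simp⟩)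
    have hd' : Disjoint ((p ⊔ Ideal.span {x 1} : Ideal A) : Set A)
        (singSubmonoid (fun i => x (i + 1)) n) := by
      refine Set.disjoint_left.2 fun s hs hs' => ?_
      obtain ⟨y, hy, z, hz, rfl⟩ := Submodule.mem_sup.1 hs
      obtain ⟨b, rfl⟩ := Ideal.mem_span_singleton'.1 hz
      exact Set.disjoint_left.1 hd hy (mem_singSubmonoid_succ.2 ⟨_, hs', -b, 0, by ring⟩)
    obtain ⟨q, hq, hle, hqd⟩ := Ideal.exists_le_prime_disjoint _ _ hd'
    obtain ⟨Q, rfl, hprime, hmono, hmem⟩ := ih hq hqd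
    refine ⟨fun i => Nat.casesOn i p Q, rfl, ?_, ?_, ?_⟩
    · rintro (_ | i) hi
      · exact hp
      · exact hprime i (by omega)
    · rintro (_ | i) hi
      · exact le_sup_left.trans hle
      · exact hmono i (by omega)
    · rintro (_ | i) hi
      · exact ⟨hle (Ideal.mem_sup_right (Ideal.mem_span_singleton_self _)), hx⟩
      · exact hmem i (by omega)

theorem disjoint_of_chain {A : Type*} [CommRing A] {x : ℕ → A} {n : ℕ} {P : ℕ → Ideal A}
    (hprime : ∀ i ≤ n, (P i).IsPrime) (hmono : ∀ i < n, P i ≤ P (i + 1))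
    (hmem : ∀ i < n, x (i + 1) ∈ P (i + 1) ∧ x (i + 1) ∉ P i) :
    Disjoint (P 0 : Set A) (singSubmonoid x n) := by
  refine Set.disjoint_left.2 fun y hy hyS => ?_
  have hP := hprime 0 (Nat.zero_le _)
  induction n generalizing x P y with
  | zero =>
    obtain rfl := Submonoid.mem_bot.1 hyS
    exact hP.one_notMem hy
  | succ n ih =>
    obtain ⟨s, hs, b, k, rfl⟩ := mem_singSubmonoid_succ.1 hyS
    obtain ⟨hx₁, hx₀⟩ := hmem 0 n.succ_pos
    have hsum : s + b * x 1 ∈ P 0 :=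
      (hP.mem_or_mem hy).resolve_left fun h => hx₀ (hP.mem_of_pow_mem _ h)
    have hs₁ : s ∈ P 1 :=
      ((P 1).add_mem_iff_left ((P 1).mul_mem_left b hx₁)).1 (hmono 0 n.succ_pos hsum)
    exact ih (x := fun i => x (i + 1)) (P := fun i => P (i + 1))
      (fun i hi => hprime _ (by omega)) (fun i hi => hmono _ (by omega))
      (fun i hi => hmem _ (by omega)) s hs₁ hs (hprime 1 (by omega))

/-- A sequence `(x₁,…,x_ℓ)` is not singular (i.e. is pseudo-regular) iff there
is an increasing chain of primes `P₀ ⊆ ⋯ ⊆ P_ℓ` with `xᵢ ∈ Pᵢ ∖ P_{i-1}` for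
each `i = 1,…,ℓ`. -/
theorem not_singular_iff_chain_of_primes {A : Type*} [CommRing A]
    (x : ℕ → A) (ℓ : ℕ) :
    ¬ IsSingular x ℓ ↔
      ∃ P : ℕ → Ideal A, (∀ i ≤ ℓ, (P i).IsPrime) ∧
        (∀ i k, i ≤ k → k ≤ ℓ → P i ≤ P k) ∧
        (∀ i, 1 ≤ i → i ≤ ℓ → x i ∈ P i ∧ x i ∉ P (i - 1)) := by
  rw [isSingular_iff_zero_mem]
  constructor
  · intro h
    have hbot : Disjoint ((⊥ : Ideal A) : Set A) (singSubmonoid x ℓ) :=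
      Set.disjoint_left.2 fun y hy hyS => h (by rwa [← Ideal.mem_bot.1 hy])
    obtain ⟨p, hp, -, hd⟩ := Ideal.exists_le_prime_disjoint _ _ hbot
    obtain ⟨P, -, hprime, hmono, hmem⟩ := exists_chain_of_disjoint hp hd
    refine ⟨P, hprime, fun i k hik => ?_, fun i hi hil => ?_⟩
    · induction k, hik using Nat.le_induction with
      | base => exact fun _ => le_rfl
      | succ k _ ih => exact fun hk => (ih (by omega)).trans (hmono k hk)
    · obtain ⟨j, rfl⟩ := Nat.exists_eq_add_of_le' hi
      exact hmem j hil
  · rintro ⟨P, hprime, hmono, hmem⟩ h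
    exact Set.disjoint_left.1 (disjoint_of_chain hprime
      (fun i hi => hmono i (i + 1) (by omega) hi)
      (fun i hi => hmem (i + 1) (by omega) hi)) (P 0).zero_mem h
end

section
/- Let A be a commutative ring and x₁, …, x_ℓ ∈ A. If the sequence (x₁,…,x_ℓ) is regular in the sense of Bourbaki (for each i, xᵢ is a nonzerodivisor on A/⟨x₁,…,x_{i−1}⟩) and the ideal ⟨x₁,…,x_ℓ⟩ is not the whole ring, then the sequence (x₁,…,x_ℓ) is not singular. -/
open RingTheory.Sequence in
open scoped Pointwise in
/-- If `singVal x a m ℓ` kills `v` in a module on which `x₁,…,x_ℓ` is weakly regular, then `v`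
lies in `⟨x₁,…,x_ℓ⟩ M`. -/
theorem mem_ofList_smul_top_of_singVal_smul_eq_zero {A : Type*} [CommRing A] (ℓ : ℕ)
    {M : Type*} [AddCommGroup M] [Module A M] (x a : ℕ → A) (m : ℕ → ℕ)
    (hreg : IsWeaklyRegular M (List.ofFn fun i : Fin ℓ => x (i.1 + 1)))
    (v : M) (hv : singVal x a m ℓ • v = 0) :
    v ∈ Ideal.ofList (List.ofFn fun i : Fin ℓ => x (i.1 + 1)) • (⊤ : Submodule A M) := by
  induction ℓ generalizing M x a m with
  | zero =>
    rw [singVal, one_smul] at hv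
    exact hv ▸ zero_mem _
  | succ n ih =>
    rw [List.ofFn_succ] at hreg ⊢
    simp only [Fin.val_zero, Fin.val_succ, zero_add] at hreg ⊢
    rw [isWeaklyRegular_cons_iff] at hreg
    obtain ⟨hx, htail⟩ := hreg
    rw [singVal, mul_smul] at hv
    have hcancel := (hx.pow (m 1)).right_eq_zero_of_smul hv
    rw [add_smul] at hcancel
    have hquot := ih (fun i => x (i + 1)) (fun i => a (i + 1)) (fun i => m (i + 1)) htail
      (Submodule.Quotient.mk v) (by
        rw [← Submodule.Quotient.mk_smul, Submodule.Quotient.mk_eq_zero,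
          eq_neg_of_add_eq_zero_left hcancel, mul_comm, mul_smul, ← smul_neg]
        exact Submodule.smul_mem_pointwise_smul _ _ _ Submodule.mem_top)
    rw [Ideal.ofList_cons_smul]
    have hmap : (Ideal.ofList (List.ofFn fun i : Fin n => x (i.1 + 1 + 1)) •
          (⊤ : Submodule A (QuotSMulTop (x 1) M))) =
        (Ideal.ofList (List.ofFn fun i : Fin n => x (i.1 + 1 + 1)) • (⊤ : Submodule A M)).map
          (x 1 • (⊤ : Submodule A M)).mkQ := by
      rw [Submodule.map_smul'', Submodule.map_top, Submodule.range_mkQ]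
    rw [hmap, ← Submodule.mkQ_apply, ← Submodule.mem_comap, Submodule.comap_map_mkQ] at hquot
    exact hquot

/-- A regular sequence (in the sense of Bourbaki, i.e. a weakly regular
sequence) which does not generate the unit ideal is not singular. -/
theorem isWeaklyRegular_not_span_top_not_singular {A : Type*} [CommRing A]
    (x : ℕ → A) (ℓ : ℕ)
    (hreg : RingTheory.Sequence.IsWeaklyRegular A (List.ofFn fun i : Fin ℓ => x (i.1 + 1)))
    (hne : Ideal.span (Set.range fun i : Fin ℓ => x (i.1 + 1)) ≠ ⊤) :
    ¬ IsSingular x ℓ := by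
  rintro ⟨a, m, h⟩
  apply hne
  have hone := mem_ofList_smul_top_of_singVal_smul_eq_zero ℓ x a m hreg (1 : A) (by simp [h])
  rw [Ideal.eq_top_iff_one]
  simpa [Ideal.ofList, List.mem_ofFn', Set.range] using hone
end

section
/- Let A be a commutative ring and let (x₁,…,x_ℓ) and (y₁,…,y_ℓ) be two sequences in A such that for each j, xⱼ divides some power of yⱼ and yⱼ divides some power of xⱼ. Then the sequence (x₁,…,x_ℓ) is singular if and only if the sequence (y₁,…,y_ℓ) is singular. -/
/-- The iterated boundary ideal `(I : x^∞) + (x)` of `x` relative to `I`. -/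
def boundaryIdeal {A : Type*} [CommRing A] (I : Ideal A) (x : A) : Ideal A where
  carrier := {v | ∃ (m : ℕ) (a : A), x ^ m * (v + a * x) ∈ I}
  zero_mem' := ⟨0, 0, by simp⟩
  add_mem' := by
    rintro v w ⟨m, a, hv⟩ ⟨n, b, hw⟩
    refine ⟨m + n, a + b, ?_⟩
    have hsum := I.add_mem (I.mul_mem_left (x ^ n) hv) (I.mul_mem_left (x ^ m) hw)
    convert hsum using 1
    ring
  smul_mem' := by
    rintro c v ⟨m, a, hv⟩
    refine ⟨m, c * a, ?_⟩
    convert I.mul_mem_left c hv using 1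
    rw [smul_eq_mul]
    ring

theorem self_mem_boundaryIdeal {A : Type*} [CommRing A] (I : Ideal A) (x : A) :
    x ∈ boundaryIdeal I x :=
  ⟨0, -1, by simp⟩

/-- Up to radical, the boundary ideal only depends on the radicals of `I` and of `(x)`. -/
theorem boundaryIdeal_le_radical {A : Type*} [CommRing A] {I J : Ideal A} {x y : A}
    (hIJ : I ≤ J.radical) (hxy : ∃ n : ℕ, x ∣ y ^ n) (hyx : ∃ n : ℕ, y ∣ x ^ n) :
    boundaryIdeal I x ≤ (boundaryIdeal J y).radical := by
  rintro v ⟨m, a, hv⟩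
  obtain ⟨n, c, hc⟩ := hxy
  obtain ⟨k, hk⟩ := hyx
  obtain ⟨N, hN⟩ := hIJ hv
  have hx : x ∈ (boundaryIdeal J y).radical :=
    ⟨k, Ideal.mem_of_dvd _ hk (self_mem_boundaryIdeal J y)⟩
  have hvx : v + a * x ∈ (boundaryIdeal J y).radical := by
    refine ⟨N, n * m * N, 0, ?_⟩
    have hmul := J.mul_mem_left (c ^ (m * N)) hN
    convert hmul using 1
    rw [mul_assoc n, pow_mul, hc, mul_pow (x ^ m)]
    ring
  simpa using Ideal.sub_mem _ hvx (Ideal.mul_mem_left _ a hx)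

theorem singVal_congr {A : Type*} [CommRing A] (ℓ : ℕ) {x a a' : ℕ → A} {m m' : ℕ → ℕ}
    (ha : ∀ i, a (i + 1) = a' (i + 1)) (hm : ∀ i, m (i + 1) = m' (i + 1)) :
    singVal x a m ℓ = singVal x a' m' ℓ := by
  cases ℓ with
  | zero => rfl
  | succ ℓ => simp only [singVal, funext ha, funext hm, ha 0, hm 0]

theorem exists_singVal_succ_mem_iff {A : Type*} [CommRing A] (I : Ideal A) (x : ℕ → A) (ℓ : ℕ) :
    (∃ a m, singVal x a m (ℓ + 1) ∈ I) ↔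
      ∃ a m, singVal (fun i => x (i + 1)) a m ℓ ∈ boundaryIdeal I (x 1) := by
  constructor
  · rintro ⟨a, m, h⟩
    exact ⟨fun i => a (i + 1), fun i => m (i + 1), m 1, a 1, h⟩
  · rintro ⟨a, m, k, b, h⟩
    refine ⟨fun i => if i = 1 then b else a (i - 1), fun i => if i = 1 then k else m (i - 1), ?_⟩
    rw [singVal, singVal_congr ℓ (a' := a) (m' := m)]
    · simpa using h
    all_goals simp

theorem exists_singVal_mem_of_le_radical {A : Type*} [CommRing A] (ℓ : ℕ) {x y : ℕ → A}
    {I J : Ideal A} (hIJ : I ≤ J.radical)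
    (h : ∀ i, 1 ≤ i → i ≤ ℓ → (∃ n : ℕ, x i ∣ y i ^ n) ∧ (∃ n : ℕ, y i ∣ x i ^ n))
    (hx : ∃ a m, singVal x a m ℓ ∈ I) : ∃ a m, singVal y a m ℓ ∈ J := by
  induction ℓ generalizing x y I J with
  | zero =>
    obtain ⟨a, m, hx⟩ := hx
    obtain ⟨n, hn⟩ := hIJ hx
    exact ⟨a, m, by simpa [singVal] using hn⟩
  | succ ℓ ih =>
    rw [exists_singVal_succ_mem_iff] at hx ⊢
    obtain ⟨hxy, hyx⟩ := h 1 le_rfl (by omega)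
    exact ih (boundaryIdeal_le_radical hIJ hxy hyx)
      (fun i _ hi => h (i + 1) (by omega) (by omega)) hx

theorem IsSingular.of_mutual_div_pow {A : Type*} [CommRing A] {x y : ℕ → A} {ℓ : ℕ}
    (h : ∀ i, 1 ≤ i → i ≤ ℓ → (∃ n : ℕ, x i ∣ y i ^ n) ∧ (∃ n : ℕ, y i ∣ x i ^ n))
    (hx : IsSingular x ℓ) : IsSingular y ℓ :=
  exists_singVal_mem_of_le_radical (I := ⊥) (J := ⊥) ℓ Ideal.le_radical h hx

/-- If for each `j`, `xⱼ` divides a power of `yⱼ` and `yⱼ` divides a power of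
`xⱼ`, then `(x₁,…,x_ℓ)` is singular iff `(y₁,…,y_ℓ)` is singular. -/
theorem isSingular_iff_of_mutual_div_pow {A : Type*} [CommRing A]
    (x y : ℕ → A) (ℓ : ℕ)
    (h : ∀ i, 1 ≤ i → i ≤ ℓ → (∃ n : ℕ, x i ∣ y i ^ n) ∧ (∃ n : ℕ, y i ∣ x i ^ n)) :
    IsSingular x ℓ ↔ IsSingular y ℓ :=
  ⟨.of_mutual_div_pow h, .of_mutual_div_pow fun i hi hl => (h i hi hl).symm⟩
end

section
/- Let A be a commutative ring, I, U ⊆ A subsets and a ∈ A. For every x ∈ A of the form x = i₁ + u₁ with i₁ in the ideal generated by I and u₁ in the multiplicative submonoid generated by U ∪ {a}, and every y ∈ A of the form y = i₂ + u₂ with i₂ in the ideal generated by I ∪ {a} and u₂ in the multiplicative submonoid generated by U, there exist x₁, y₁ ∈ A such that x₁·x + y₁·y = i₃ + u₃ for some i₃ in the ideal generated by I and u₃ in the multiplicative submonoid generated by U. -/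
/-- The monoids `S(I, a; U)` and `S(I; a, U)` cover the monoid `S(I; U)`:
for `x ∈ ⟨I⟩ + M(U ∪ {a})` and `y ∈ ⟨I ∪ {a}⟩ + M(U)` there are `x₁, y₁` with
`x₁·x + y₁·y ∈ ⟨I⟩ + M(U)`. -/
theorem monoid_cover {A : Type*} [CommRing A] (I U : Set A) (a : A) (x y : A)
    (hx : ∃ i₁ ∈ Ideal.span I, ∃ u₁ ∈ Submonoid.closure (insert a U), x = i₁ + u₁)
    (hy : ∃ i₂ ∈ Ideal.span (insert a I), ∃ u₂ ∈ Submonoid.closure U, y = i₂ + u₂) :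
    ∃ x₁ y₁ : A, ∃ i₃ ∈ Ideal.span I, ∃ u₃ ∈ Submonoid.closure U,
      x₁ * x + y₁ * y = i₃ + u₃ := by
  obtain ⟨i₁, hi₁, u₁, hu₁, rfl⟩ := hx
  obtain ⟨i₂, hi₂, v, hv, rfl⟩ := hy
  rw [Set.insert_eq, Submonoid.closure_union, Submonoid.mem_sup] at hu₁
  obtain ⟨p, hp, u, hu, rfl⟩ := hu₁
  obtain ⟨n, rfl⟩ := Submonoid.mem_closure_singleton.mp hp
  obtain ⟨b, j, hj, rfl⟩ := Ideal.mem_span_insert.mp hi₂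
  -- `v + b * a` divides `v ^ n - (-(b * a)) ^ n`, with quotient `q`.
  obtain ⟨q, hq⟩ := sub_dvd_pow_sub_pow v (-(b * a)) n
  refine ⟨(-b) ^ n, u * q, (-b) ^ n * i₁ + u * q * j,
    add_mem (Ideal.mul_mem_left _ _ hi₁) (Ideal.mul_mem_left _ _ hj),
    u * v ^ n, mul_mem hu (pow_mem hv n), ?_⟩
  rw [← neg_mul, mul_pow] at hq
  linear_combination -u * hq
end

section
/- Let A be a commutative ring, n ∈ ℕ, and u₁, …, uₙ ∈ A; set u_{n+1} = 1. Suppose s₁, …, s_{n+1} ∈ A are such that for each i ∈ {1,…,n+1} there exist kᵢ ∈ ℕ and tᵢ in the ideal generated by {u₁,…,u_{i−1}} with sᵢ = uᵢ^{kᵢ} + tᵢ. Then the ideal generated by {s₁, …, s_{n+1}} is the whole ring A (i.e., there exist a₁,…,a_{n+1} ∈ A with Σ aᵢ·sᵢ = 1). -/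
/-- The monoids `S(∅; u₁), S({u₁}; u₂), …, S({u₁,…,u_{n-1}}; uₙ),
S({u₁,…,uₙ}; 1)` are comaximal: if `sᵢ = uᵢ^{kᵢ} + tᵢ` with `tᵢ` in the ideal
generated by `u₁,…,u_{i-1}` (where `u_{n+1} = 1`), then `s₁,…,s_{n+1}`
generate the unit ideal. -/
theorem comaximal_monoids {A : Type*} [CommRing A] (n : ℕ) (u : ℕ → A)
    (hu : u (n + 1) = 1) (s : ℕ → A)
    (hs : ∀ i, 1 ≤ i → i ≤ n + 1 →
      ∃ k : ℕ, ∃ t ∈ Ideal.span {b : A | ∃ j, 1 ≤ j ∧ j < i ∧ b = u j},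
        s i = u i ^ k + t) :
    ∃ a : ℕ → A, ∑ i ∈ Finset.Icc 1 (n + 1), a i * s i = 1 := by
  set J : Ideal A := Ideal.span (s '' (Finset.Icc 1 (n + 1) : Finset ℕ))
  have mem_radical : ∀ i, 1 ≤ i → i ≤ n + 1 → u i ∈ J.radical := by
    intro i
    induction i using Nat.strong_induction_on with
    | _ i ih =>
      intro h1 h2
      obtain ⟨k, t, ht, hst⟩ := hs i h1 h2
      have ht' : t ∈ J.radical := by
        refine Ideal.span_le.2 ?_ ht
        rintro _ ⟨j, hj1, hji, rfl⟩
        exact ih j hji hj1 (by omega)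
      have hsJ : s i ∈ J.radical :=
        Ideal.le_radical (Ideal.subset_span ⟨i, by simp [h1, h2], rfl⟩)
      have hpow : u i ^ k ∈ J.radical := by
        rw [eq_sub_of_add_eq hst.symm]
        exact sub_mem hsJ ht'
      exact J.radical_isRadical ⟨k, hpow⟩
  have one_mem : (1 : A) ∈ J := by
    obtain ⟨m, hm⟩ := mem_radical (n + 1) (by omega) le_rfl
    simpa [hu] using hm
  obtain ⟨a, ha⟩ := (Submodule.mem_span_image_finset_iff_exists_fun' A).1 one_mem
  exact ⟨a, by simpa only [smul_eq_mul] using ha⟩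
end

section
/- Let A be a commutative ring and S₁, …, Sₙ multiplicative submonoids of A which are comaximal: for every choice of elements s₁ ∈ S₁, …, sₙ ∈ Sₙ, the ideal generated by {s₁,…,sₙ} is the whole ring A. Then for any ℓ ∈ ℕ, the Krull dimension of A is at most ℓ if and only if for each i, the Krull dimension of the localization of A at Sᵢ is at most ℓ. -/
/-- If `S₁,…,Sₙ` are comaximal, every proper ideal is disjoint from some `Sᵢ`. -/
theorem Ideal.exists_disjoint_of_comaximal {A : Type*} [CommRing A] {n : ℕ}
    {S : Fin n → Submonoid A}
    (hcom : ∀ s : Fin n → A, (∀ i, s i ∈ S i) →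
      ∃ a : Fin n → A, ∑ i, a i * s i = 1)
    {I : Ideal A} (hI : I ≠ ⊤) : ∃ i, Disjoint (S i : Set A) (I : Set A) := by
  by_contra! h
  choose s hsS hsI using fun i ↦ Set.not_disjoint_iff.mp (h i)
  obtain ⟨a, ha⟩ := hcom s hsS
  exact hI (I.eq_top_of_isUnit_mem
    (I.sum_mem fun i _ ↦ I.mul_mem_left (a i) (hsI i)) (ha ▸ isUnit_one))

/-- The Krull dimension does not increase under localization. -/
theorem ringKrullDim_localization_le {A : Type*} [CommRing A] (M : Submonoid A) :
    ringKrullDim (Localization M) ≤ ringKrullDim A := by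
  rw [ringKrullDim_le_iff_height_le]
  intro P hP
  rw [← IsLocalization.height_under M P]
  exact (ringKrullDim_le_iff_height_le _).mp le_rfl (hP.under A)

/-- Local-global principle for Krull dimension: if `S₁,…,Sₙ` are comaximal
multiplicative submonoids of `A`, then `A` has Krull dimension `≤ ℓ` iff each
localization `A_{Sᵢ}` has Krull dimension `≤ ℓ`. -/
theorem ringKrullDim_le_iff_of_comaximal {A : Type*} [CommRing A]
    (n : ℕ) (S : Fin n → Submonoid A)
    (hcom : ∀ s : Fin n → A, (∀ i, s i ∈ S i) →
      ∃ a : Fin n → A, ∑ i, a i * s i = 1)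
    (ℓ : ℕ) :
    ringKrullDim A ≤ ℓ ↔ ∀ i, ringKrullDim (Localization (S i)) ≤ ℓ := by
  refine ⟨fun h i ↦ (ringKrullDim_localization_le (S i)).trans h, fun h ↦ ?_⟩
  rw [ringKrullDim_le_iff_height_le]
  intro P hP
  obtain ⟨i, hi⟩ := Ideal.exists_disjoint_of_comaximal hcom hP.ne_top
  have hprime := IsLocalization.isPrime_of_isPrime_disjoint (S i) (Localization (S i)) P hP hi
  rw [← IsLocalization.height_map_of_disjoint (S := Localization (S i)) (S i) P hi]
  exact (ringKrullDim_le_iff_height_le _).mp (h i) hprime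
end

section
/- Let T be a bounded distributive lattice, ℓ ∈ ℕ, and let ((J₀,U₀),…,(J_ℓ,U_ℓ)) be a family of ℓ+1 pairs of finite subsets of T. Fix a ∈ T and an index i ∈ {0,…,ℓ}. If the chain obtained by replacing Jᵢ with Jᵢ ∪ {a} collapses, and the chain obtained by replacing Uᵢ with Uᵢ ∪ {a} collapses, then the chain ((J₀,U₀),…,(J_ℓ,U_ℓ)) collapses. -/
/-- A finite idealistic chain `((J₀,U₀),…,(J_ℓ,U_ℓ))` in a bounded distributive
lattice collapses if there are `x₁,…,x_ℓ` with `x₁ ⊓ inf U₀ ≤ sup J₀`,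
`x_{k+1} ⊓ inf U_k ≤ sup J_k ⊔ x_k` for `1 ≤ k ≤ ℓ-1` and
`inf U_ℓ ≤ sup J_ℓ ⊔ x_ℓ`.  (This is encoded uniformly by a sequence
`x₀,…,x_{ℓ+1}` with `x₀ = ⊥` and `x_{ℓ+1} = ⊤`.) -/
def LatChainCollapses {T : Type*} [DistribLattice T] [BoundedOrder T]
    (J U : ℕ → Finset T) (ℓ : ℕ) : Prop :=
  ∃ x : ℕ → T, x 0 = ⊥ ∧ x (ℓ + 1) = ⊤ ∧
    ∀ k ≤ ℓ, x (k + 1) ⊓ (U k).inf id ≤ (J k).sup id ⊔ x k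

/-- Cut rule in a distributive lattice. -/
theorem le_of_le_sup_of_inf_le {T : Type*} [DistribLattice T] {a p q : T}
    (h₁ : p ≤ q ⊔ a) (h₂ : p ⊓ a ≤ q) : p ≤ q :=
  calc p ≤ p ⊓ (q ⊔ a) := le_inf le_rfl h₁
    _ = p ⊓ q ⊔ p ⊓ a := inf_sup_left _ _ _
    _ ≤ q := sup_le inf_le_right h₂

/-- Simultaneous collapse for idealistic chains in a distributive lattice:
if the chain obtained by adding `a` to `Jᵢ` collapses and the chain obtained
by adding `a` to `Uᵢ` collapses, then the chain collapses. -/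
theorem simultaneous_collapse_lattice_chains {T : Type*} [DistribLattice T]
    [BoundedOrder T] [DecidableEq T] (J U : ℕ → Finset T) (ℓ : ℕ)
    (a : T) (i : ℕ) (hi : i ≤ ℓ)
    (h1 : LatChainCollapses (Function.update J i (insert a (J i))) U ℓ)
    (h2 : LatChainCollapses J (Function.update U i (insert a (U i))) ℓ) :
    LatChainCollapses J U ℓ := by
  obtain ⟨x, hx0, hx1, hx⟩ := h1
  obtain ⟨y, hy0, hy1, hy⟩ := h2
  refine ⟨fun k => if k ≤ i then x k ⊔ y k else x k ⊓ y k, by simp [hx0, hy0], ?_, ?_⟩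
  · simp [hx1, hy1, show ¬ ℓ + 1 ≤ i by omega]
  intro k hk
  have hxk := hx k hk
  have hyk := hy k hk
  rcases lt_trichotomy k i with h | rfl | h
  · rw [Function.update_of_ne h.ne] at hxk hyk
    simp only [show k + 1 ≤ i by omega, h.le, if_true]
    rw [inf_sup_right]
    exact sup_le (hxk.trans (sup_le_sup_left le_sup_left _))
      (hyk.trans (sup_le_sup_left le_sup_right _))
  · rw [Function.update_self, Finset.sup_insert, id] at hxk
    rw [Function.update_self, Finset.inf_insert, id] at hyk
    simp only [show ¬ k + 1 ≤ k by omega, le_refl, if_true, if_false]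
    apply le_of_le_sup_of_inf_le (a := a)
    · refine (inf_le_inf_right _ inf_le_left).trans (hxk.trans ?_)
      exact sup_le (sup_le le_sup_right (le_sup_left.trans le_sup_left))
        ((le_sup_left.trans le_sup_right).trans le_sup_left)
    · refine le_trans ?_ (hyk.trans (sup_le_sup_left le_sup_right _))
      exact le_inf ((inf_le_left.trans inf_le_left).trans inf_le_right)
        (le_inf inf_le_right (inf_le_left.trans inf_le_right))
  · rw [Function.update_of_ne h.ne'] at hxk hyk
    simp only [show ¬ k + 1 ≤ i by omega, h.not_ge, if_false]
    rw [sup_inf_left]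
    exact le_inf ((inf_le_inf_right _ inf_le_left).trans hxk)
      ((inf_le_inf_right _ inf_le_right).trans hyk)
end

section
/- Let T be a bounded distributive lattice, ℓ ∈ ℕ, and let x₀ ≤ x₁ ≤ ⋯ ≤ x_ℓ and a₀, a₁, …, a_ℓ be elements of T such that (x₀,…,x_ℓ) and (a₀,…,a_ℓ) are complementary sequences. Define b_ℓ = a_ℓ and b_i = a_i ⊓ b_{i+1} for i < ℓ. Then b₀ ≤ b₁ ≤ ⋯ ≤ b_ℓ and the sequences (x₀,…,x_ℓ) and (b₀,…,b_ℓ) are complementary. -/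
/-- Two sequences `(x₀,…,x_ℓ)` and `(y₀,…,y_ℓ)` in a bounded lattice are
complementary if `x₀ ⊓ y₀ ≤ ⊥`, `xᵢ ⊓ yᵢ ≤ x_{i-1} ⊔ y_{i-1}` for
`1 ≤ i ≤ ℓ`, and `⊤ ≤ x_ℓ ⊔ y_ℓ`. -/
def LatComplementary {T : Type*} [Lattice T] [BoundedOrder T]
    (x y : ℕ → T) (ℓ : ℕ) : Prop :=
  x 0 ⊓ y 0 ≤ ⊥ ∧ (∀ i, 1 ≤ i → i ≤ ℓ → x i ⊓ y i ≤ x (i - 1) ⊔ y (i - 1)) ∧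
    ⊤ ≤ x ℓ ⊔ y ℓ

/-- If `x₀ ≤ ⋯ ≤ x_ℓ` and `(a₀,…,a_ℓ)` are complementary, and
`b_ℓ = a_ℓ`, `b_i = a_i ⊓ b_{i+1}`, then `b₀ ≤ ⋯ ≤ b_ℓ` and `(x₀,…,x_ℓ)`,
`(b₀,…,b_ℓ)` are complementary. -/
theorem complementary_monotone_of_complementary {T : Type*} [DistribLattice T]
    [BoundedOrder T] (ℓ : ℕ) (x a b : ℕ → T)
    (hmono : ∀ i, i < ℓ → x i ≤ x (i + 1))
    (hcomp : LatComplementary x a ℓ)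
    (hbl : b ℓ = a ℓ) (hb : ∀ i, i < ℓ → b i = a i ⊓ b (i + 1)) :
    (∀ i, i < ℓ → b i ≤ b (i + 1)) ∧ LatComplementary x b ℓ := by
  obtain ⟨h0, hstep, htop⟩ := hcomp
  have hba : ∀ i, i ≤ ℓ → b i ≤ a i := fun i hi => by
    rcases hi.eq_or_lt with rfl | hi
    · exact hbl.le
    · exact (hb i hi).trans_le inf_le_left
  refine ⟨fun i hi => (hb i hi).trans_le inf_le_right,
    (inf_le_inf_left _ (hba 0 ℓ.zero_le)).trans h0, ?_, hbl ▸ htop⟩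
  rintro (_ | j) h1 hj
  · omega
  · rw [Nat.add_sub_cancel, hb j hj, sup_inf_left]
    exact le_inf ((inf_le_inf_left _ (hba _ hj)).trans (hstep _ h1 hj))
      (inf_le_right.trans le_sup_right)
end

section
/- Let T be a bounded distributive lattice and ℓ ∈ ℕ. If every monotone sequence x₀ ≤ x₁ ≤ ⋯ ≤ x_ℓ in T admits a complementary sequence, then every sequence (y₀,…,y_ℓ) of ℓ+1 elements of T admits a complementary sequence. -/
/-- If every monotone sequence `x₀ ≤ ⋯ ≤ x_ℓ` in a bounded distributive
lattice admits a complementary sequence, then every sequence of `ℓ+1` elements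
admits a complementary sequence. -/
theorem complementary_of_monotone_complementary {T : Type*} [DistribLattice T]
    [BoundedOrder T] (ℓ : ℕ)
    (h : ∀ x : ℕ → T, (∀ i, i < ℓ → x i ≤ x (i + 1)) →
      ∃ y : ℕ → T, LatComplementary x y ℓ) :
    ∀ y : ℕ → T, ∃ z : ℕ → T, LatComplementary y z ℓ := by
  intro y
  obtain ⟨w, hbot, hstep, htop⟩ := h (partialSups y) fun i _ =>
    (partialSups y).monotone i.le_succ
  let z : ℕ → T := fun n => Nat.casesOn n (w 0) fun k => w (k + 1) ⊔ partialSups y k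
  have hsup : ∀ n, y n ⊔ z n = partialSups y n ⊔ w n := by
    rintro (_ | n)
    · simp [z]
    · simp only [z, partialSups_add_one]
      ac_rfl
  refine ⟨z, by simpa [z] using hbot, ?_, htop.trans_eq (hsup ℓ).symm⟩
  rintro (_ | i) hi hiℓ
  · omega
  · have hw := hstep (i + 1) hi hiℓ
    simp only [Nat.add_sub_cancel] at hw ⊢
    rw [hsup, inf_sup_left]
    exact sup_le ((inf_le_inf_right _ (le_partialSups y (i + 1))).trans hw)
      (inf_le_right.trans le_sup_left)
end

section
/- Let T and V be bounded distributive lattices and α : T → V a bounded lattice homomorphism which is injective (lying over) and going up, i.e., for all a, b ∈ T and y ∈ V with α(a) ≤ α(b) ⊔ y there exists x ∈ T with a ≤ b ⊔ x and α(x) ≤ y. If every sequence of ℓ+1 elements of V admits a complementary sequence, then every sequence of ℓ+1 elements of T admits a complementary sequence (i.e., the Krull dimension of T is at most that of V). -/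
/-- A going up injective homomorphism lets one pull back, from the top index downwards, a sequence
complementary to the image of `x`, with an arbitrary element `t` in place of `⊤`. -/
theorem exists_pullback_of_goingUp {T V : Type*}
    [DistribLattice T] [BoundedOrder T] [DistribLattice V] [BoundedOrder V]
    (α : BoundedLatticeHom T V) (hinj : Function.Injective α)
    (hgu : ∀ a b : T, ∀ y : V, α a ≤ α b ⊔ y → ∃ x : T, a ≤ b ⊔ x ∧ α x ≤ y)
    (x : ℕ → T) (z : ℕ → V) (hbot : α (x 0) ⊓ z 0 ≤ ⊥) (n : ℕ)
    (hstep : ∀ i < n, α (x (i + 1)) ⊓ z (i + 1) ≤ α (x i) ⊔ z i)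
    (t : T) (ht : α t ≤ α (x n) ⊔ z n) :
    ∃ y : ℕ → T, x 0 ⊓ y 0 ≤ ⊥ ∧
      (∀ i < n, x (i + 1) ⊓ y (i + 1) ≤ x i ⊔ y i) ∧ t ≤ x n ⊔ y n := by
  induction n generalizing t with
  | zero =>
    obtain ⟨u, htu, huz⟩ := hgu _ _ _ ht
    refine ⟨fun _ => u, le_of_eq (hinj ?_), by simp, htu⟩
    rw [map_inf, map_bot]
    exact le_bot_iff.mp ((inf_le_inf_left _ huz).trans hbot)
  | succ n ih =>
    obtain ⟨u, htu, huz⟩ := hgu _ _ _ ht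
    obtain ⟨y, hy0, hy, hyn⟩ := ih (fun i hi => hstep i (by omega)) (x (n + 1) ⊓ u) (by
      rw [map_inf]
      exact (inf_le_inf_left _ huz).trans (hstep n (by omega)))
    refine ⟨Function.update y (n + 1) u, by simpa using hy0, fun i hi => ?_, by simpa using htu⟩
    rcases Nat.lt_succ_iff_lt_or_eq.mp hi with h | rfl
    · rw [Function.update_of_ne (by omega), Function.update_of_ne (by omega)]
      exact hy i h
    · rw [Function.update_self, Function.update_of_ne (by omega)]
      exact hyn

/-- If `α : T → V` is an injective (lying over) bounded lattice homomorphism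
which is going up, and every sequence of `ℓ+1` elements of `V` admits a
complementary sequence, then so does every sequence of `ℓ+1` elements of `T`:
`dim T ≤ dim V`. -/
theorem dim_le_of_lyingOver_goingUp {T V : Type*}
    [DistribLattice T] [BoundedOrder T] [DistribLattice V] [BoundedOrder V]
    (α : BoundedLatticeHom T V) (hinj : Function.Injective α)
    (hgu : ∀ a b : T, ∀ y : V, α a ≤ α b ⊔ y →
      ∃ x : T, a ≤ b ⊔ x ∧ α x ≤ y)
    (ℓ : ℕ)
    (hV : ∀ w : ℕ → V, ∃ z : ℕ → V, LatComplementary w z ℓ) :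
    ∀ x : ℕ → T, ∃ y : ℕ → T, LatComplementary x y ℓ := by
  intro x
  obtain ⟨z, hz0, hz, hzl⟩ := hV fun i => α (x i)
  obtain ⟨y, hy0, hy, hyl⟩ := exists_pullback_of_goingUp α hinj hgu x z hz0 ℓ
    (fun i hi => hz (i + 1) (by omega) hi) ⊤ (by rwa [map_top])
  refine ⟨y, hy0, fun i hi hil => ?_, hyl⟩
  obtain ⟨j, rfl⟩ := Nat.exists_eq_add_of_le' hi
  exact hy j hil
end

section
/- Let A be a commutative ring and r, n ∈ ℕ. If the Krull dimension of A is at most r, then the Krull dimension of the polynomial ring A[X₁,…,Xₙ] (equivalently, MvPolynomial (Fin n) A) is at most r + n + r·n = (r+1)(n+1) − 1. -/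
/-- If `dim A ≤ r` then `dim A[X₁,…,Xₙ] ≤ r + n + r·n = (r+1)(n+1) - 1`. -/
theorem ringKrullDim_mvPolynomial_le {A : Type*} [CommRing A] (r n : ℕ)
    (h : ringKrullDim A ≤ r) :
    ringKrullDim (MvPolynomial (Fin n) A) ≤ (r + n + r * n : ℕ) := by
  have fiber_dim_le (p : PrimeSpectrum A) :
      Order.krullDim (PrimeSpectrum.comap (algebraMap A (MvPolynomial (Fin n) A)) ⁻¹' {p}) ≤ n := by
    rw [Order.krullDim_eq_of_orderIso
        (PrimeSpectrum.preimageOrderIsoFiber A (MvPolynomial (Fin n) A) p), ← ringKrullDim,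
      ringKrullDim_eq_of_ringEquiv
        (MvPolynomial.algebraTensorAlgEquiv A p.asIdeal.ResidueField).toRingEquiv,
      MvPolynomial.ringKrullDim_of_isNoetherianRing, ringKrullDim_eq_zero_of_field]
    simp
  calc ringKrullDim (MvPolynomial (Fin n) A) ≤ (n + 1) * ringKrullDim A + n :=
        Order.krullDim_le_of_krullDim_preimage_le' _ (fun _ _ hab ↦ Ideal.comap_mono hab)
          fiber_dim_le
    _ ≤ (n + 1) * (r : WithBot ℕ∞) + n := by gcongr
    _ = (r + n + r * n : ℕ) := by push_cast; ring
end

section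
/- Let K be a field, A a nontrivial commutative K-algebra, and y₁, …, y_r ∈ A elements which are algebraically independent over K and such that A is a finitely generated module over the K-subalgebra K[y₁,…,y_r] generated by y₁, …, y_r (Noether position). Then the Krull dimension of A equals r. -/
/-- An injective integral extension of commutative rings preserves the Krull dimension. -/
theorem Algebra.IsIntegral.ringKrullDim_eq (R S : Type*) [CommRing R] [CommRing S] [Algebra R S]
    [Algebra.IsIntegral R S] [FaithfulSMul R S] : ringKrullDim S = ringKrullDim R := by
  refine le_antisymm (Order.krullDim_le_of_strictMono (PrimeSpectrum.comap (algebraMap R S))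
    fun _ _ h ↦ Ideal.IsIntegral.comap_lt_comap h) (iSup_le fun l ↦ ?_)
  obtain ⟨q, hq⟩ := Algebra.IsIntegral.comap_surjective R S l.head
  have : q.asIdeal.LiesOver l.head.asIdeal := ⟨congrArg PrimeSpectrum.asIdeal hq.symm⟩
  obtain ⟨L, hL, -⟩ := Ideal.exists_ltSeries_of_hasGoingUp l q.asIdeal
  exact hL ▸ Order.LTSeries.length_le_krullDim L

/-- Noether position: if `A` is a nontrivial commutative algebra over a field
`K`, and `y₁,…,y_r ∈ A` are algebraically independent over `K` with `A` a
finitely generated module over the subalgebra `K[y₁,…,y_r]`, then the Krull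
dimension of `A` equals `r`. -/
theorem ringKrullDim_eq_of_noether_position {K : Type*} [Field K]
    {A : Type*} [CommRing A] [Nontrivial A] [Algebra K A] (r : ℕ)
    (y : Fin r → A) (hy : AlgebraicIndependent K y)
    (hfin : Module.Finite (Algebra.adjoin K (Set.range y)) A) :
    ringKrullDim A = r := by
  rw [Algebra.IsIntegral.ringKrullDim_eq (Algebra.adjoin K (Set.range y)) A,
    ← ringKrullDim_eq_of_ringEquiv hy.aevalEquiv.toRingEquiv,
    MvPolynomial.ringKrullDim_of_isNoetherianRing, ringKrullDim_eq_zero_of_field]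
  simp
end
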